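/- If $G$ is a connected graph and $\{H_1, H_2, \dots, H_k\}$ is a partition of $V(G)$ into sets each inducing a connected subgraph, then $rx_3(G) \leq k - 1 + \sum_{i=1}^{k} rx_3(H_i)$. -/

import Mathlib

open SimpleGraph

/-- An edge-coloring `c` is a `k`-rainbow coloring of `G` if every `k`-set of vertices
is contained in a rainbow tree: a subgraph of `G` that is a tree, contains the `k` vertices,
and whose edges receive pairwise distinct colors. -/
def IsRainbowColoring {V : Type*} [Fintype V] (G : SimpleGraph V) {α : Type*}
    (c : Sym2 V → α) (k : ℕ) : Prop :=
  ∀ S : Finset V, S.card = k →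
    ∃ T : G.Subgraph, (↑S : Set V) ⊆ T.verts ∧ T.coe.IsTree ∧ Set.InjOn c T.edgeSet

/-- The `k`-rainbow index of `G`: the minimum number of colors in a `k`-rainbow coloring. -/
noncomputable def rxk {V : Type*} [Fintype V] (G : SimpleGraph V) (k : ℕ) : ℕ :=
  sInf {q | ∃ c : Sym2 V → Fin q, IsRainbowColoring G c k}

/-- A connected subgraph has a spanning tree. -/
theorem SimpleGraph.Subgraph.Connected.exists_isTree_le {V : Type*} [Finite V]
    {G : SimpleGraph V} {T : G.Subgraph} (hT : T.Connected) :
    ∃ T' ≤ T, T'.verts = T.verts ∧ T'.coe.IsTree := by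
  obtain ⟨F, hF, hFt⟩ := SimpleGraph.Connected.exists_isTree_le hT.coe
  let T' : G.Subgraph :=
    { verts := T.verts
      Adj := fun a b => ∃ (ha : a ∈ T.verts) (hb : b ∈ T.verts), F.Adj ⟨a, ha⟩ ⟨b, hb⟩
      adj_sub := fun ⟨_, _, h⟩ => T.adj_sub (hF h)
      edge_vert := fun ⟨ha, _, _⟩ => ha
      symm := ⟨fun _ _ ⟨ha, hb, h⟩ => ⟨hb, ha, h.symm⟩⟩ }
  have hcoe : T'.coe = F := by
    ext ⟨a, ha⟩ ⟨b, hb⟩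
    exact ⟨fun ⟨_, _, h⟩ => h, fun h => ⟨ha, hb, h⟩⟩
  exact ⟨T', ⟨subset_rfl, fun _ _ ⟨_, _, h⟩ => hF h⟩, rfl, hcoe ▸ hFt⟩

/-- The image of a connected subgraph under a homomorphism is connected. -/
theorem SimpleGraph.Subgraph.Connected.map_hom {V W : Type*} {G : SimpleGraph V}
    {K : SimpleGraph W} {T : K.Subgraph} (hT : T.Connected) (f : K →g G) :
    (T.map f).Connected := by
  let g : T.coe →g (T.map f).coe :=
    { toFun := fun v => ⟨f v, Set.mem_image_of_mem f v.2⟩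
      map_rel' := fun {a b} h => ⟨a, b, h, rfl, rfl⟩ }
  refine ⟨hT.coe.map g ?_⟩
  rintro ⟨_, v, hv, rfl⟩
  exact ⟨⟨v, hv⟩, rfl⟩

/-- The edges of `G` admit a coloring with `q` colors for which any three, not necessarily distinct,
vertices of `s` lie in a rainbow connected subgraph with vertices in `s`. -/
def RainbowColorableOn {V : Type*} (G : SimpleGraph V) (s : Set V) (q : ℕ) : Prop :=
  ∃ c : Sym2 V → ℕ, (∀ e, c e < q) ∧ ∀ x ∈ s, ∀ y ∈ s, ∀ z ∈ s,
    ∃ T : G.Subgraph, T.verts ⊆ s ∧ x ∈ T.verts ∧ y ∈ T.verts ∧ z ∈ T.verts ∧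
      T.Connected ∧ Set.InjOn c T.edgeSet

/-- A connected graph attains its rainbow index. -/
theorem exists_isRainbowColoring_rxk {W : Type*} [Fintype W] {K : SimpleGraph W}
    (hK : K.Connected) (k : ℕ) : ∃ c : Sym2 W → Fin (rxk K k), IsRainbowColoring K c k := by
  classical
  refine Nat.sInf_mem (s := {q | ∃ c : Sym2 W → Fin q, IsRainbowColoring K c k})
    ⟨Fintype.card (Sym2 W), Fintype.equivFin _, fun S _ => ?_⟩
  have htop : (⊤ : K.Subgraph).Connected := ⟨Subgraph.topIso.connected_iff.mpr hK⟩
  obtain ⟨T, -, hv, hT⟩ := htop.exists_isTree_le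
  exact ⟨T, by simp [hv], hT, (Fintype.equivFin _).injective.injOn⟩

theorem Sym2.eq_of_not_isDiag_of_card_le_two {W : Type*} [Fintype W] (hW : Fintype.card W ≤ 2)
    {e f : Sym2 W} (he : ¬ e.IsDiag) (hf : ¬ f.IsDiag) : e = f := by
  classical
  have key : ∀ a b c : W, a ≠ b → c = a ∨ c = b := by
    intro a b c hab
    by_contra! h
    have := Finset.card_le_univ {a, b, c}
    rw [Finset.card_eq_three.mpr ⟨a, b, c, hab, h.1.symm, h.2.symm, rfl⟩] at this
    omega
  induction e with | _ a b
  induction f with | _ c d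
  rw [Sym2.mk_isDiag_iff] at he hf
  have h1 := key a b c he
  have h2 := key a b d he
  grind [Sym2.eq_iff]

theorem rainbowColorableOn_rxk_induce {V : Type*} (G : SimpleGraph V) (s : Set V) [Fintype s]
    (hs : (G.induce s).Connected) : RainbowColorableOn G s (rxk (G.induce s) 3) := by
  classical
  obtain ⟨c, hc⟩ := exists_isRainbowColoring_rxk hs 3
  obtain ⟨w⟩ := hs.nonempty
  have hinj : Function.Injective (Sym2.map (Subtype.val : s → V)) :=
    Sym2.map.injective Subtype.val_injective
  have key : ∀ x y z : s, ∃ T : (G.induce s).Subgraph, x ∈ T.verts ∧ y ∈ T.verts ∧ z ∈ T.verts ∧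
      T.Connected ∧ Set.InjOn c T.edgeSet := by
    intro x y z
    by_cases hcard : 3 ≤ Fintype.card s
    · obtain ⟨S, hS, hS3⟩ := Finset.exists_superset_card_eq (s := {x, y, z})
        Finset.card_le_three hcard
      obtain ⟨T, hST, hT, hTc⟩ := hc S hS3
      exact ⟨T, hST (hS (by simp)), hST (hS (by simp)), hST (hS (by simp)), ⟨hT.connected⟩, hTc⟩
    · refine ⟨⊤, trivial, trivial, trivial, ⟨Subgraph.topIso.connected_iff.mpr hs⟩, ?_⟩
      intro e he f hf _
      exact Sym2.eq_of_not_isDiag_of_card_le_two (by omega)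
        (SimpleGraph.not_isDiag_of_mem_edgeSet _ (Subgraph.edgeSet_subset _ he))
        (SimpleGraph.not_isDiag_of_mem_edgeSet _ (Subgraph.edgeSet_subset _ hf))
  refine ⟨Function.extend (Sym2.map Subtype.val) (fun e => (c e : ℕ)) fun _ => c s(w, w), ?_, ?_⟩
  · intro e
    by_cases he : ∃ e' : Sym2 s, Sym2.map Subtype.val e' = e
    · obtain ⟨e', rfl⟩ := he
      rw [hinj.extend_apply]
      exact (c e').2
    · rw [Function.extend_apply' _ _ _ he]
      exact (c _).2
  · intro x hx y hy z hz
    obtain ⟨T, hxT, hyT, hzT, hT, hTc⟩ := key ⟨x, hx⟩ ⟨y, hy⟩ ⟨z, hz⟩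
    refine ⟨T.map (Embedding.induce s).toHom, ?_, ⟨_, hxT, rfl⟩, ⟨_, hyT, rfl⟩, ⟨_, hzT, rfl⟩,
      hT.map_hom _, ?_⟩
    · rintro _ ⟨v, -, rfl⟩
      exact v.2
    · rw [Subgraph.edgeSet_map]
      rintro _ ⟨e, he, rfl⟩ _ ⟨f, hf, rfl⟩ hef
      have hef' : (c e : ℕ) = c f := by
        rw [← hinj.extend_apply (fun e => (c e : ℕ)) (fun _ => (c s(w, w) : ℕ)) e,
          ← hinj.extend_apply (fun e => (c e : ℕ)) (fun _ => (c s(w, w) : ℕ)) f]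
        exact hef
      rw [hTc he hf (Fin.ext hef')]

/-- Joining two disjoint vertex sets along an edge costs one additional color. -/
theorem RainbowColorableOn.union {V : Type*} {G : SimpleGraph V} {s t : Set V} {p q : ℕ}
    (hs : RainbowColorableOn G s p) (ht : RainbowColorableOn G t q) (hst : Disjoint s t)
    {a b : V} (ha : a ∈ s) (hb : b ∈ t) (hab : G.Adj a b) :
    RainbowColorableOn G (s ∪ t) (p + q + 1) := by
  classical
  obtain ⟨c, hcp, hc⟩ := hs
  obtain ⟨d, hdq, hd⟩ := ht
  have hst' : ∀ v ∈ s, v ∉ t := fun _ hv => Set.disjoint_left.mp hst hv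
  let γ : Sym2 V → ℕ := fun e =>
    if ∀ v ∈ e, v ∈ s then c e else if ∀ v ∈ e, v ∈ t then p + d e else p + q
  have γs : ∀ e, (∀ v ∈ e, v ∈ s) → γ e = c e := fun e he => if_pos he
  have γt : ∀ e, (∀ v ∈ e, v ∈ t) → γ e = p + d e := by
    intro e he
    have : ¬ ∀ v ∈ e, v ∈ s := fun h =>
      hst' _ (h _ e.out_fst_mem) (he _ e.out_fst_mem)
    simp only [γ, if_neg this, if_pos he]
  have γab : γ s(a, b) = p + q := by
    have h1 : ¬ ∀ v ∈ s(a, b), v ∈ s := fun h => hst' b (h b (by simp)) hb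
    have h2 : ¬ ∀ v ∈ s(a, b), v ∈ t := fun h => hst' a ha (h a (by simp))
    simp only [γ, if_neg h1, if_neg h2]
  have mem : ∀ {T : G.Subgraph} {r : Set V}, T.verts ⊆ r → ∀ e ∈ T.edgeSet, ∀ v ∈ e, v ∈ r :=
    fun hT e he v hv => hT (Subgraph.mem_verts_of_mem_edge he hv)
  have injs : ∀ {T : G.Subgraph}, T.verts ⊆ s → Set.InjOn c T.edgeSet →
      Set.InjOn γ T.edgeSet := by
    intro T hT hc e he f hf hef
    rw [γs e (mem hT e he), γs f (mem hT f hf)] at hef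
    exact hc he hf hef
  have injt : ∀ {T : G.Subgraph}, T.verts ⊆ t → Set.InjOn d T.edgeSet →
      Set.InjOn γ T.edgeSet := by
    intro T hT hc e he f hf hef
    rw [γt e (mem hT e he), γt f (mem hT f hf)] at hef
    exact hc he hf (by omega)
  refine ⟨γ, ?_, ?_⟩
  · intro e
    have := hcp e
    have := hdq e
    simp only [γ]
    split_ifs <;> omega
  intro x hx y hy z hz
  by_cases h1 : x ∈ s ∧ y ∈ s ∧ z ∈ s
  · obtain ⟨T, hTs, hxT, hyT, hzT, hT, hTc⟩ := hc x h1.1 y h1.2.1 z h1.2.2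
    exact ⟨T, hTs.trans Set.subset_union_left, hxT, hyT, hzT, hT, injs hTs hTc⟩
  by_cases h2 : x ∈ t ∧ y ∈ t ∧ z ∈ t
  · obtain ⟨T, hTs, hxT, hyT, hzT, hT, hTc⟩ := hd x h2.1 y h2.2.1 z h2.2.2
    exact ⟨T, hTs.trans Set.subset_union_right, hxT, hyT, hzT, hT, injt hTs hTc⟩
  let f : V → V := fun v => if v ∈ s then v else a
  let g : V → V := fun v => if v ∈ t then v else b
  have hf : ∀ v, f v ∈ s := fun v => by simp only [f]; split_ifs <;> assumption
  have hg : ∀ v, g v ∈ t := fun v => by simp only [g]; split_ifs <;> assumption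
  obtain ⟨T, hTs, hxT, hyT, hzT, hT, hTc⟩ := hc _ (hf x) _ (hf y) _ (hf z)
  obtain ⟨U, hUt, hxU, hyU, hzU, hU, hUc⟩ := hd _ (hg x) _ (hg y) _ (hg z)
  have haT : a ∈ T.verts := by grind
  have hbU : b ∈ U.verts := by grind
  have hfg : ∀ v ∈ s ∪ t, f v ∈ T.verts → g v ∈ U.verts →
      v ∈ (T ⊔ G.subgraphOfAdj hab ⊔ U).verts := by
    intro v hv h3 h4
    rcases hv with hv | hv
    · exact Or.inl (Or.inl (by simpa only [f, if_pos hv] using h3))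
    · exact Or.inr (by simpa only [g, if_pos hv] using h4)
  refine ⟨T ⊔ G.subgraphOfAdj hab ⊔ U, ?_, hfg x hx hxT hxU, hfg y hy hyT hyU, hfg z hz hzT hzU,
    ?_, ?_⟩
  · rintro v ((hv | hv) | hv)
    · exact Or.inl (hTs hv)
    · rcases hv with rfl | rfl
      · exact Or.inl ha
      · exact Or.inr hb
    · exact Or.inr (hUt hv)
  · refine Subgraph.connected_sup (Subgraph.connected_sup hT.preconnected
      (Subgraph.subgraphOfAdj_connected hab).preconnected ⟨a, haT, by simp⟩).preconnected
      hU.preconnected ⟨b, Or.inr (by simp), hbU⟩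
  · have iT := injs hTs hTc
    have iU := injt hUt hUc
    have lT : ∀ e ∈ T.edgeSet, γ e < p := fun e he => by
      rw [γs e (mem hTs e he)]; exact hcp e
    have lU : ∀ e ∈ U.edgeSet, p ≤ γ e ∧ γ e < p + q := fun e he => by
      rw [γt e (mem hUt e he)]; have := hdq e; omega
    simp only [Subgraph.edgeSet_sup, edgeSet_subgraphOfAdj]
    rintro e ((he | he) | he) e' ((he' | he') | he') hee
    · exact iT he he' hee
    · rw [he', γab] at hee; have := lT e he; omega
    · have := lT e he; have := lU e' he'; omega
    · rw [he, γab] at hee; have := lT e' he'; omega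
    · rw [he, he']
    · rw [he, γab] at hee; have := lU e' he'; omega
    · have := lT e' he'; have := lU e he; omega
    · rw [he', γab] at hee; have := lU e he; omega
    · exact iU he he' hee

theorem RainbowColorableOn.rxk_le {V : Type*} [Fintype V] {G : SimpleGraph V} {q : ℕ}
    (h : RainbowColorableOn G Set.univ q) : rxk G 3 ≤ q := by
  classical
  obtain ⟨c, hcq, hc⟩ := h
  refine Nat.sInf_le ⟨fun e => ⟨c e, hcq e⟩, fun S hS => ?_⟩
  obtain ⟨x, y, z, -, -, -, rfl⟩ := Finset.card_eq_three.mp hS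
  obtain ⟨T, -, hx, hy, hz, hT, hTc⟩ := hc x trivial y trivial z trivial
  obtain ⟨T', hle, hv, hT'⟩ := hT.exists_isTree_le
  refine ⟨T', ?_, hT', ?_⟩
  · rw [hv]
    intro v hv
    simp only [Finset.coe_insert, Finset.coe_singleton, Set.mem_insert_iff,
      Set.mem_singleton_iff] at hv
    rcases hv with rfl | rfl | rfl <;> assumption
  · intro e he f hf hef
    exact hTc (Subgraph.edgeSet_mono hle he) (Subgraph.edgeSet_mono hle hf) (Fin.mk.inj hef)

theorem SimpleGraph.Connected.exists_adj_mem_notMem {V : Type*} {G : SimpleGraph V}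
    (hG : G.Connected) {s : Set V} {u v : V} (hu : u ∈ s) (hv : v ∉ s) :
    ∃ a ∈ s, ∃ b ∉ s, G.Adj a b := by
  obtain ⟨p⟩ := hG.preconnected u v
  obtain ⟨d, -, h1, h2⟩ := p.exists_boundary_dart s hu hv
  exact ⟨d.fst, h1, d.snd, h2, d.adj⟩

theorem stmt_6 {V : Type*} [Fintype V] [DecidableEq V] (G : SimpleGraph V) (hG : G.Connected)
    (k : ℕ) (hk : 0 < k) (H : Fin k → Finset V)
    (hdisj : ∀ i j, i ≠ j → Disjoint (H i) (H j))
    (hcover : ∀ v : V, ∃ i, v ∈ H i)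
    (hconn : ∀ i, (G.induce (↑(H i) : Set V)).Connected) :
    rxk G 3 ≤ k - 1 + ∑ i, rxk (G.induce (↑(H i) : Set V)) 3 := by
  have base : ∀ i, RainbowColorableOn G (H i) (rxk (G.induce (↑(H i) : Set V)) 3) :=
    fun i => rainbowColorableOn_rxk_induce G _ (hconn i)
  have grow : ∀ n < k, ∃ I : Finset (Fin k), I.card = n + 1 ∧
      RainbowColorableOn G {v | ∃ i ∈ I, v ∈ H i}
        (n + ∑ i ∈ I, rxk (G.induce (↑(H i) : Set V)) 3) := by
    intro n
    induction n with
    | zero => exact fun _ => ⟨{⟨0, hk⟩}, by simp, by simpa using base ⟨0, hk⟩⟩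
    | succ n ih =>
      intro hn
      obtain ⟨I, hI, hcol⟩ := ih (by omega)
      obtain ⟨i, hi⟩ : I.Nonempty := Finset.card_pos.mp (by omega)
      obtain ⟨j, hj⟩ : ∃ j, j ∉ I := by
        by_contra! h
        have := Finset.card_eq_iff_eq_univ I |>.mpr (Finset.eq_univ_iff_forall.mpr h)
        rw [Fintype.card_fin] at this
        omega
      obtain ⟨u, hu⟩ := (hconn i).nonempty
      obtain ⟨w, hw⟩ := (hconn j).nonempty
      have hnot : ∀ l ∉ I, ∀ v ∈ H l, ¬ ∃ i ∈ I, v ∈ H i := by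
        rintro l hl v hv ⟨m, hm, hvm⟩
        exact Finset.disjoint_left.mp (hdisj l m fun h => hl (h ▸ hm)) hv hvm
      obtain ⟨a, ha, b, hb, hab⟩ := hG.exists_adj_mem_notMem
        (s := {v | ∃ i ∈ I, v ∈ H i}) ⟨i, hi, hu⟩ (hnot j hj w hw)
      obtain ⟨l, hl⟩ := hcover b
      have hlI : l ∉ I := fun h => hb ⟨l, h, hl⟩
      refine ⟨insert l I, by rw [Finset.card_insert_of_notMem hlI, hI], ?_⟩
      have := hcol.union (base l)
        (Set.disjoint_right.mpr fun v hv => hnot l hlI v hv) ha hl hab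
      convert this using 1
      · ext v
        simp [or_comm]
      · rw [Finset.sum_insert hlI]
        omega
  obtain ⟨I, hI, hcol⟩ := grow (k - 1) (by omega)
  obtain rfl : I = Finset.univ :=
    (Finset.card_eq_iff_eq_univ I).mp (by rw [hI, Fintype.card_fin]; omega)
  refine RainbowColorableOn.rxk_le ?_
  convert hcol
  ext v
  simpa using hcover v
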